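/- arXiv:1512.08695 — 2 statements merged into one kernel-verified Lean document; each statement's English description precedes it below -/
import Mathlib

section
/- Let (G,+) be a semimodule over a discrete semiring (R,+,·) and let S ⊆ G be a weak central set of (G,+). Then for every finite set F ⊆ G one can find a syndetic subset N_F of (R,+) such that for each d ∈ N_F there exists an element a ∈ S with a + d•F ⊆ S, where a + d•F = {a + d•g : g ∈ F}. -/
universe u

/-- A subset `N` of `(G,+)` is syndetic if there is a finite set `K ⊆ G` such that
`N ∩ (g + K) ≠ ∅` for every `g ∈ G`. -/
def Syndetic {G : Type*} [Add G] (N : Set G) : Prop :=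
  ∃ K : Finset G, ∀ g : G, ∃ k ∈ K, g + k ∈ N

/-- A witness that `S` is a weak central set of the discrete additive commutative monoid
`G`: a topological dynamical system `φ : G × X → X` on a compact Hausdorff space `X`, a
point `x`, a uniformly recurrent point `y` weakly proximal to `x` (their orbit closures
intersect), and an open neighborhood `U` of `y` such that `S = {g : G | φ g x ∈ U}`. -/
structure WeakCentralWitness (G : Type u) [AddCommMonoid G] (S : Set G) :
    Type (u + 1) where
  X : Type u
  [topX : TopologicalSpace X]
  [compX : CompactSpace X]
  [t2X : T2Space X]
  φ : G → X → X
  hid : ∀ z : X, φ 0 z = z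
  hadd : ∀ g h : G, ∀ z : X, φ (g + h) z = φ g (φ h z)
  hcont : ∀ g : G, Continuous (φ g)
  x : X
  y : X
  hur : ∀ V : Set X, IsOpen V → y ∈ V → Syndetic {g : G | φ g y ∈ V}
  hwp : (closure (Set.range fun g : G => φ g x) ∩
    closure (Set.range fun g : G => φ g y)).Nonempty
  U : Set X
  hUopen : IsOpen U
  hyU : y ∈ U
  hS : S = {g : G | φ g x ∈ U}

/-- `S` is a weak central set of `(G,+)`. -/
def IsWeakCentral {G : Type u} [AddCommMonoid G] (S : Set G) : Prop :=
  Nonempty (WeakCentralWitness G S)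

/-- The complement of a non-syndetic set contains all nonempty subset sums of arbitrarily long
finite sequences. -/
theorem exists_forall_sum_notMem_of_not_syndetic {M ι : Type*} [AddCommMonoid M] {N : Set M}
    (hN : ¬ Syndetic N) (T : Finset ι) :
    ∃ d : ι → M, ∀ s ⊆ T, s.Nonempty → ∑ i ∈ s, d i ∉ N := by
  classical
  induction T using Finset.induction_on with
  | empty =>
    refine ⟨0, fun s hs hne => ?_⟩
    simp_all
  | insert i T hi ih =>
    obtain ⟨d, hd⟩ := ih
    simp only [Syndetic, not_exists, not_forall, not_and] at hN
    obtain ⟨r, hr⟩ := hN (T.powerset.image fun s => ∑ j ∈ s, d j)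
    have sum_update (s : Finset ι) (his : i ∉ s) :
        ∑ j ∈ s, Function.update d i r j = ∑ j ∈ s, d j :=
      Finset.sum_congr rfl fun j hj =>
        Function.update_of_ne (ne_of_mem_of_not_mem hj his) _ _
    refine ⟨Function.update d i r, fun s hs hne => ?_⟩
    by_cases his : i ∈ s
    · rw [← Finset.add_sum_erase s _ his, Function.update_self,
        sum_update _ (Finset.notMem_erase i s)]
      exact hr _ (Finset.mem_image_of_mem _
        (Finset.mem_powerset.2 (Finset.subset_insert_iff.1 hs)))
    · rw [sum_update s his]
      exact hd s ((Finset.subset_insert_iff_of_notMem his).1 hs) hne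

/-- A point weakly proximal to a uniformly recurrent point `y` visits every neighborhood
of `y`. -/
theorem WeakCentralWitness.exists_mem_of_isOpen {G : Type u} [AddCommMonoid G] {S : Set G}
    (w : WeakCentralWitness G S) {V : Set w.X} (hV : @IsOpen _ w.topX V) (hy : w.y ∈ V) :
    ∃ g : G, w.φ g w.x ∈ V := by
  let _ := w.topX
  have := w.compX
  have := w.t2X
  obtain ⟨z, hzx, hzy⟩ := w.hwp
  obtain ⟨C, hC, hCc, hCV⟩ := exists_mem_nhds_isClosed_subset (hV.mem_nhds hy)
  obtain ⟨K, hK⟩ := w.hur (interior C) isOpen_interior (mem_interior_iff_mem_nhds.2 hC)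
  have hclosed : IsClosed (⋃ k ∈ K, w.φ k ⁻¹' C) :=
    K.finite_toSet.isClosed_biUnion fun k _ => hCc.preimage (w.hcont k)
  have hsub : Set.range (fun g : G => w.φ g w.y) ⊆ ⋃ k ∈ K, w.φ k ⁻¹' C := by
    rintro _ ⟨g, rfl⟩
    obtain ⟨k, hk, hgk⟩ := hK g
    refine Set.mem_iUnion₂.2 ⟨k, hk, ?_⟩
    rw [Set.mem_preimage, ← w.hadd, add_comm]
    exact interior_subset hgk
  obtain ⟨k, -, hk⟩ := Set.mem_iUnion₂.1 (closure_minimal hsub hclosed hzy)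
  obtain ⟨_, hg, g, rfl⟩ := mem_closure_iff.1 hzx _ (hV.preimage (w.hcont k)) (hCV hk)
  exact ⟨k + g, by rw [w.hadd]; exact hg⟩

/-- Weak central sets are piecewise syndetic. -/
theorem IsWeakCentral.exists_finset_forall_exists_add_mem {G : Type u} [AddCommMonoid G]
    {S : Set G} (hS : IsWeakCentral S) :
    ∃ K : Finset G, ∀ H : Finset G, ∃ t : G, ∀ h ∈ H, ∃ k ∈ K, h + k + t ∈ S := by
  obtain ⟨w⟩ := hS
  let _ := w.topX
  obtain ⟨K, hK⟩ := w.hur w.U w.hUopen w.hyU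
  choose k hkK hk using hK
  refine ⟨K, fun H => ?_⟩
  obtain ⟨t, ht⟩ := w.exists_mem_of_isOpen (V := ⋂ h ∈ H, w.φ (h + k h) ⁻¹' w.U)
    (H.finite_toSet.isOpen_biInter fun h _ => w.hUopen.preimage (w.hcont _))
    (Set.mem_iInter₂.2 fun h _ => hk h)
  refine ⟨t, fun h hh => ⟨k h, hkK h, ?_⟩⟩
  rw [w.hS, Set.mem_ofPred_eq, w.hadd]
  exact Set.mem_iInter₂.1 ht h hh

/-- Piecewise syndetic sets contain `a + d • A` with `d` a nonempty subset sum of any sufficiently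
long finite sequence of scalars. -/
theorem exists_forall_add_sum_smul_mem {R G : Type*} [Semiring R] [AddCommMonoid G] [Module R G]
    {S : Set G} {K : Finset G}
    (hK : ∀ H : Finset G, ∃ t : G, ∀ h ∈ H, ∃ k ∈ K, h + k + t ∈ S) (A : Finset G) :
    ∃ (ι : Type) (_ : Fintype ι), ∀ d : ι → R, ∃ s : Finset ι, s.Nonempty ∧
      ∃ a : G, ∀ g ∈ A, a + (∑ i ∈ s, d i) • g ∈ S := by
  classical
  obtain ⟨ι, hι, hmono⟩ := Combinatorics.Line.exists_mono_in_high_dimension A K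
  refine ⟨ι, hι, fun d => ?_⟩
  let f : (ι → A) → G := fun v => ∑ i, d i • (v i : G)
  obtain ⟨t, ht⟩ := hK (Finset.univ.image f)
  choose k hkK hk using fun v => ht (f v) (Finset.mem_image_of_mem f (Finset.mem_univ v))
  obtain ⟨l, c, hc⟩ := hmono fun v => ⟨k v, hkK v⟩
  let b : G := ∑ i with l.idxFun i ≠ none, d i • ((l.idxFun i).elim 0 (↑) : G)
  refine ⟨Finset.univ.filter fun i => l.idxFun i = none, ?_, b + c + t, fun g hg => ?_⟩
  · obtain ⟨i, hi⟩ := l.proper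
    exact ⟨i, by simpa using hi⟩
  · have hf : f (l ⟨g, hg⟩) = (∑ i with l.idxFun i = none, d i) • g + b := by
      change ∑ i, d i • ((l ⟨g, hg⟩ i : A) : G) = _
      rw [Finset.sum_smul, ← Finset.sum_filter_add_sum_filter_not Finset.univ
        (fun i => l.idxFun i = none) fun i => d i • ((l ⟨g, hg⟩ i : A) : G)]
      congr 1
      · refine Finset.sum_congr rfl fun i hi => ?_
        rw [l.apply_none _ _ (Finset.mem_filter.1 hi).2]
      · refine Finset.sum_congr rfl fun i hi => ?_
        obtain ⟨y, hy⟩ := Option.ne_none_iff_exists'.1 (Finset.mem_filter.1 hi).2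
        rw [l.apply_some hy, hy, Option.elim_some]
    have hmem := hk (l ⟨g, hg⟩)
    have hkc : k (l ⟨g, hg⟩) = c := congrArg Subtype.val (hc ⟨g, hg⟩)
    rw [hkc, hf] at hmem
    convert hmem using 1
    abel

/-- If `S` is a weak central set of a semimodule `(G,+)` over a discrete semiring
`(R,+,·)`, then for every finite `F ⊆ G` there is a syndetic subset `N_F` of `(R,+)`
such that for each `d ∈ N_F` there is some `a ∈ S` with `a + d • F ⊆ S`. -/
theorem weakCentral_vdW {R : Type*} {G : Type u} [Semiring R] [AddCommMonoid G]
    [Module R G] (S : Set G) (hS : IsWeakCentral S) :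
    ∀ F : Finset G, ∃ N : Set R, Syndetic N ∧
      ∀ d ∈ N, ∃ a ∈ S, ∀ g ∈ F, a + d • g ∈ S := by
  classical
  intro F
  refine ⟨{d | ∃ a ∈ S, ∀ g ∈ F, a + d • g ∈ S}, ?_, fun d hd => hd⟩
  by_contra hN
  obtain ⟨K, hK⟩ := hS.exists_finset_forall_exists_add_mem
  obtain ⟨ι, _, h⟩ := exists_forall_add_sum_smul_mem (R := R) hK (insert 0 F)
  obtain ⟨d, hd⟩ := exists_forall_sum_notMem_of_not_syndetic hN (Finset.univ : Finset ι)
  obtain ⟨s, hs, a, ha⟩ := h d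
  refine hd s (Finset.subset_univ s) hs ⟨a, ?_, fun g hg => ha g (Finset.mem_insert_of_mem hg)⟩
  simpa using ha 0 (Finset.mem_insert_self 0 F)
end

section
/- Let (G,+) be a semimodule over a discrete semiring (R,+,·) and let G = B₁ ∪ ⋯ ∪ B_q be a partition of G into finitely many subsets with B_j ≠ ∅ for each j = 1,…,q. Then at least one of the sets B_j is a weak central set of (G,+). -/
universe u

/-- Every nonempty closed invariant set of a family of self-maps of a compact space contains
a minimal nonempty closed invariant set. -/
theorem exists_minimal_closed_invariant {ι X : Type*} [TopologicalSpace X] [CompactSpace X]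
    (φ : ι → X → X) {C : Set X} (hCc : IsClosed C) (hCne : C.Nonempty)
    (hCinv : ∀ g, Set.MapsTo (φ g) C C) :
    ∃ M ⊆ C, Minimal (fun A : Set X => IsClosed A ∧ A.Nonempty ∧ ∀ g, Set.MapsTo (φ g) A A) M := by
  refine zorn_superset_nonempty
    {A : Set X | IsClosed A ∧ A.Nonempty ∧ ∀ g, Set.MapsTo (φ g) A A} ?_ C ⟨hCc, hCne, hCinv⟩
  intro c hc hchain hcne
  refine ⟨⋂₀ c, ⟨isClosed_sInter fun A hA => (hc hA).1, ?_, ?_⟩,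
    fun A hA => Set.sInter_subset_of_mem hA⟩
  · have : Nonempty c := hcne.to_subtype
    have hdir : DirectedOn (· ⊇ ·) c := fun A hA A' hA' =>
      (hchain.total hA hA').elim (fun h => ⟨A, hA, subset_rfl, h⟩) fun h => ⟨A', hA', h, subset_rfl⟩
    exact IsCompact.nonempty_sInter_of_directed_nonempty_isCompact_isClosed
      hdir (fun A hA => (hc hA).2.1)
      (fun A hA => (hc hA).1.isCompact) (fun A hA => (hc hA).1)
  · exact fun g z hz A hA => (hc hA).2.2 g (hz A hA)

/-- The orbit closure of a point is invariant under the action. -/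
theorem mapsTo_closure_range_orbit {G X : Type*} [AddMonoid G] [TopologicalSpace X]
    {φ : G → X → X} (hadd : ∀ g h : G, ∀ z : X, φ (g + h) z = φ g (φ h z))
    (hcont : ∀ g : G, Continuous (φ g)) (z : X) (g : G) :
    Set.MapsTo (φ g) (closure (Set.range fun h => φ h z)) (closure (Set.range fun h => φ h z)) := by
  refine Set.MapsTo.closure ?_ (hcont g)
  rintro _ ⟨h, rfl⟩
  exact ⟨g + h, hadd g h z⟩

/-- Every point of a minimal closed invariant set is uniformly recurrent. -/
theorem syndetic_return_of_minimal {G X : Type*} [AddCommMonoid G] [TopologicalSpace X]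
    [CompactSpace X] {φ : G → X → X} (hadd : ∀ g h : G, ∀ z : X, φ (g + h) z = φ g (φ h z))
    (hcont : ∀ g : G, Continuous (φ g)) {M : Set X}
    (hM : Minimal (fun A : Set X => IsClosed A ∧ A.Nonempty ∧ ∀ g, Set.MapsTo (φ g) A A) M)
    {y : X} (hy : y ∈ M) {V : Set X} (hV : IsOpen V) (hyV : y ∈ V) :
    Syndetic {g : G | φ g y ∈ V} := by
  obtain ⟨hMc, -, hMinv⟩ := hM.prop
  have hvisit : M ⊆ ⋃ k : G, φ k ⁻¹' V := by
    intro z hz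
    have hsub : closure (Set.range fun h => φ h z) ⊆ M :=
      closure_minimal (by rintro _ ⟨h, rfl⟩; exact hMinv h hz) hMc
    have hyz : y ∈ closure (Set.range fun h => φ h z) :=
      hM.le_of_le ⟨isClosed_closure, (Set.range_nonempty _).closure,
        mapsTo_closure_range_orbit hadd hcont z⟩ hsub hy
    obtain ⟨_, hwV, k, rfl⟩ := mem_closure_iff.1 hyz V hV hyV
    exact Set.mem_iUnion.2 ⟨k, hwV⟩
  obtain ⟨K, hK⟩ := hMc.isCompact.elim_finite_subcover _ (fun k => hV.preimage (hcont k)) hvisit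
  refine ⟨K, fun g => ?_⟩
  obtain ⟨k, hkK, hk⟩ := Set.mem_iUnion₂.1 (hK (hMinv g hy))
  refine ⟨k, hkK, ?_⟩
  change φ (g + k) y ∈ V
  rw [add_comm, hadd]
  exact hk

/-- In any finite partition `G = B₁ ∪ ⋯ ∪ B_q` of a semimodule `(G,+)` over a discrete
semiring `(R,+,·)` with all cells nonempty, one of the cells `B j` is a weak central set
of `(G,+)`. -/
theorem exists_weakCentral_cell {R : Type*} {G : Type u} [Semiring R] [AddCommMonoid G]
    [Module R G] {q : ℕ} (B : Fin q → Set G) (hcover : (⋃ j, B j) = Set.univ)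
    (hne : ∀ j : Fin q, (B j).Nonempty) :
    ∃ j : Fin q, IsWeakCentral (B j) := by
  classical
  let φ : G → (G → Fin q → Bool) → G → Fin q → Bool := fun g f h => f (h + g)
  let x : G → Fin q → Bool := fun g j => decide (g ∈ B j)
  have hid : ∀ z, φ 0 z = z := fun z => by simp [φ]
  have hadd : ∀ g h z, φ (g + h) z = φ g (φ h z) := fun g h z => by
    funext t
    exact congrArg z (add_assoc t g h).symm
  have hcont : ∀ g, Continuous (φ g) := fun g => continuous_pi fun h => continuous_apply (h + g)
  obtain ⟨M, hMx, hM⟩ := exists_minimal_closed_invariant φ isClosed_closure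
    (Set.range_nonempty fun g => φ g x).closure (mapsTo_closure_range_orbit hadd hcont x)
  obtain ⟨y, hy⟩ := hM.prop.2.1
  have hclopen : ∀ j : Fin q, IsClopen {f : G → Fin q → Bool | f 0 j = true} := fun j =>
    (isClopen_discrete ({true} : Set Bool)).preimage
      (by fun_prop : Continuous fun f : G → Fin q → Bool => f 0 j)
  have hcell : closure (Set.range fun g => φ g x) ⊆
      ⋃ j, {f : G → Fin q → Bool | f 0 j = true} := by
    refine closure_minimal ?_ (isClosed_iUnion_of_finite fun j => (hclopen j).1)
    rintro _ ⟨g, rfl⟩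
    obtain ⟨j, hj⟩ := Set.mem_iUnion.1 (hcover ▸ Set.mem_univ g : g ∈ ⋃ j, B j)
    exact Set.mem_iUnion.2 ⟨j, by simpa [φ, x] using hj⟩
  obtain ⟨j, hj⟩ := Set.mem_iUnion.1 (hcell (hMx hy))
  exact ⟨j, ⟨{
    X := G → Fin q → Bool
    φ := φ
    hid := hid
    hadd := hadd
    hcont := hcont
    x := x
    y := y
    hur := fun V hV hyV => syndetic_return_of_minimal hadd hcont hM hy hV hyV
    hwp := ⟨y, hMx hy, subset_closure ⟨0, hid y⟩⟩
    U := {f | f 0 j = true}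
    hUopen := (hclopen j).2
    hyU := hj
    hS := by ext g; simp [φ, x] }⟩⟩
end
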